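/- arXiv:2102.12262 — 3 statements merged into one kernel-verified Lean document; each statement's English description precedes it below -/
import Mathlib

section
/- Let n be an even positive integer and X ∈ ℝ^{n×d} a fixed matrix. Let W be uniformly distributed on the set of balanced allocations {w ∈ {0,1}^n : Σ_{i=1}^n w_i = n/2}. Let φ : {0,1}^n → ℝ be any mirror-symmetric balance criterion, i.e. φ(w) = φ(1_n − w) for every w (the PCA Mahalanobis distance M_k is such a criterion), let a > 0, and suppose the acceptance event A = {φ(W) ≤ a} has positive probability. Then the conditional expectation of the covariate mean difference is zero: E[ x̄_T − x̄_C | A ] = 0, where x̄_T = (2/n) Xᵀ W and x̄_C = (2/n) Xᵀ (1_n − W). -/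
open MeasureTheory ProbabilityTheory Matrix Finset

/-- A permutation leaving a finite set invariant preserves the uniform law on that set. -/
theorem measurePreserving_uniformOn_of_preimage_eq {α : Type*} [MeasurableSpace α]
    (e : α ≃ᵐ α) {s : Set α} (hs : MeasurableSet s) (h : e ⁻¹' s = s) :
    MeasurePreserving e (uniformOn s) (uniformOn s) := by
  refine ⟨e.measurable, Measure.ext fun t ht => ?_⟩
  have hcount : MeasurePreserving e (Measure.count : Measure α) Measure.count := by
    refine ⟨e.measurable, Measure.ext fun u hu => ?_⟩
    rw [e.map_apply, Measure.count_apply (e.measurable hu), Measure.count_apply hu,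
      ← e.image_symm, e.symm.injective.encard_image]
  rw [e.map_apply, uniformOn, cond_apply hs, cond_apply hs,
    ← hcount.measure_preimage (hs.inter ht).nullMeasurableSet, Set.preimage_inter, h]

/-- The measurable equivalence exchanging treatment and control for every unit. -/
def flipAllocation (ι : Type*) : (ι → Bool) ≃ᵐ (ι → Bool) :=
  MeasurableEquiv.piCongrRight fun _ =>
    { Equiv.boolNot with
      measurable_toFun := measurable_of_finite _
      measurable_invFun := measurable_of_finite _ }

@[simp]
theorem flipAllocation_apply {ι : Type*} (w : ι → Bool) :
    flipAllocation ι w = fun i => ! w i := rfl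

/-- Flipping an allocation of an even number of units preserves balance. -/
theorem balanced_not_iff {n : ℕ} (hn : Even n) (w : Fin n → Bool) :
    ∑ i, (if (! w i) then 1 else 0 : ℕ) = n / 2 ↔
      ∑ i, (if w i then 1 else 0 : ℕ) = n / 2 := by
  have h : ∑ i, (if (! w i) then 1 else 0 : ℕ) + ∑ i, (if w i then 1 else 0 : ℕ) = n := by
    rw [← Finset.sum_add_distrib, Finset.sum_congr rfl (g := fun _ => 1)]
    · simp
    · intro i _
      cases w i <;> rfl
  obtain ⟨k, rfl⟩ := hn
  lia

/-- For an even positive `n`, a fixed covariate matrix `X ∈ ℝ^{n×d}`,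
`W` uniform on balanced allocations, and any mirror-symmetric balance criterion `φ`
(such as the PCA Mahalanobis distance `M_k`), conditioning on the acceptance event
`{φ(W) ≤ a}` (of positive probability) leaves the covariate mean difference unbiased:
`E[x̄_T − x̄_C | φ(W) ≤ a] = 0`. Allocations are encoded as `w : Fin n → Bool`,
with real indicator vector `fun i => if w i then 1 else 0`. -/
theorem pca_rerandomization_unbiased_covariates
    (n d : ℕ) (hn : 0 < n) (hneven : Even n)
    (X : Matrix (Fin n) (Fin d) ℝ)
    (φ : (Fin n → Bool) → ℝ)
    (hφ : ∀ w, φ w = φ (fun i => ! w i))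
    (a : ℝ) (ha : 0 < a)
    (B : Set (Fin n → Bool))
    (hB : B = {w | ∑ i, (if w i then 1 else 0 : ℕ) = n / 2})
    (μ : Measure (Fin n → Bool)) (hμ : μ = uniformOn B)
    (A : Set (Fin n → Bool)) (hA : A = {w | φ w ≤ a})
    (hpos : μ A ≠ 0)
    (xT xC : (Fin n → Bool) → (Fin d → ℝ))
    (hxT : ∀ w, xT w = ((2 : ℝ) / n) • Xᵀ.mulVec (fun i => if w i then 1 else 0))
    (hxC : ∀ w, xC w = ((2 : ℝ) / n) • Xᵀ.mulVec (fun i => if w i then 0 else 1)) :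
    ∫ w, (xT w - xC w) ∂(μ[|A]) = 0 := by
  have hcond : μ[|A] = uniformOn (B ∩ A) := by
    rw [hμ, uniformOn, uniformOn,
      cond_cond_eq_cond_inter (Set.toFinite B).measurableSet (Set.toFinite A).measurableSet]
  have hinv : flipAllocation (Fin n) ⁻¹' (B ∩ A) = B ∩ A := by
    ext w
    simp only [hB, hA, Set.mem_preimage, Set.mem_inter_iff, Set.mem_ofPred_eq,
      flipAllocation_apply, ← hφ w, balanced_not_iff hneven w]
  have hflip := (measurePreserving_uniformOn_of_preimage_eq (flipAllocation (Fin n))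
    (Set.toFinite (B ∩ A)).measurableSet hinv).integral_comp'
      (fun w => xT w - xC w)
  have hswap (w : Fin n → Bool) :
      xT (flipAllocation _ w) - xC (flipAllocation _ w) = -(xT w - xC w) := by
    have hT : xT (flipAllocation _ w) = xC w := by
      rw [hxT, hxC]
      congr 2
      ext i
      cases h : w i <;> simp [h]
    have hC : xC (flipAllocation _ w) = xT w := by
      rw [hxT, hxC]
      congr 2
      ext i
      cases h : w i <;> simp [h]
    rw [hT, hC, neg_sub]
  simp only [hswap, integral_neg] at hflip
  rw [hcond]
  exact self_eq_neg.mp hflip.symm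
end

section
/- Let n be an even positive integer, and fix potential outcomes y_i(0), y_i(1) ∈ ℝ for i = 1,…,n, with sample average treatment effect τ = (1/n) Σ_{i=1}^n (y_i(1) − y_i(0)). Let W be uniformly distributed on the set of balanced allocations {w ∈ {0,1}^n : Σ_{i=1}^n w_i = n/2}, let φ : {0,1}^n → ℝ be any mirror-symmetric balance criterion (φ(w) = φ(1_n − w) for all w), let a > 0, and suppose the event A = {φ(W) ≤ a} has positive probability. Define the observed outcome y_i = W_i y_i(1) + (1 − W_i) y_i(0) and the difference-in-means estimator τ̂ = (2/n){Wᵀ y − (1_n − W)ᵀ y}. Then E[ τ̂ | A ] = τ. -/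
open MeasureTheory ProbabilityTheory Matrix Finset

/-- Conditioning the counting measure on a set invariant under an involution gives a measure
preserved by that involution. -/
lemma measurePreserving_cond_count_of_involutive {α : Type*} [Finite α] [MeasurableSpace α]
    [MeasurableSingletonClass α] {f : α → α} (hf : Function.Involutive f) {S : Set α}
    (hS : f ⁻¹' S = S) :
    MeasurePreserving f (Measure.count[|S]) (Measure.count[|S]) := by
  have hfm : Measurable f := measurable_of_finite f
  refine ⟨hfm, Measure.ext fun s hs => ?_⟩
  have hinter : S ∩ f ⁻¹' s = f '' (S ∩ s) := by
    rw [Set.image_eq_preimage_of_inverse hf.leftInverse hf.rightInverse, Set.preimage_inter, hS]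
  rw [Measure.map_apply hfm hs, cond_apply S.toFinite.measurableSet,
    cond_apply S.toFinite.measurableSet, hinter, Measure.count_injective_image hf.injective]

/-- If a function and its composition with a measure-preserving map average pointwise to a
constant, that constant is the mean of the function. -/
lemma integral_eq_of_add_comp_eq {α : Type*} [Finite α] [MeasurableSpace α]
    [MeasurableSingletonClass α] {ν : Measure α} [IsProbabilityMeasure ν] {f : α → α}
    (hf : MeasurePreserving f ν ν) {g : α → ℝ} {c : ℝ} (hg : ∀ x, g x + g (f x) = 2 * c) :
    ∫ x, g x ∂ν = c := by
  have hcomp : ∫ x, g (f x) ∂ν = ∫ x, g x ∂ν := by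
    conv_rhs => rw [← hf.map_eq]
    exact (integral_map hf.aemeasurable (measurable_of_finite g).aestronglyMeasurable).symm
  have hadd : ∫ x, (g x + g (f x)) ∂ν = ∫ x, g x ∂ν + ∫ x, g (f x) ∂ν :=
    integral_add Integrable.of_finite Integrable.of_finite
  simp only [hg, integral_const, probReal_univ, smul_eq_mul, one_mul] at hadd
  linarith

/-- Swapping the two groups preserves the balance of an allocation. -/
lemma sum_ite_not_eq_half {n : ℕ} (hn : Even n) {w : Fin n → Bool}
    (hw : ∑ i, (if w i then 1 else 0 : ℕ) = n / 2) :
    ∑ i, (if !w i then 1 else 0 : ℕ) = n / 2 := by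
  have hadd : ∑ i, (if w i then 1 else 0 : ℕ) + ∑ i, (if !w i then 1 else 0 : ℕ) = n := by
    rw [← Finset.sum_add_distrib,
      Finset.sum_congr rfl (g := fun _ => 1) fun i _ => by cases w i <;> rfl]
    simp
  obtain ⟨k, rfl⟩ := hn
  omega

/-- For an even positive `n`, fixed potential outcomes `y₀, y₁`, sample
average treatment effect `τ`, `W` uniform on balanced allocations, a mirror-symmetric
balance criterion `φ`, and an acceptance event `{φ(W) ≤ a}` of positive probability,
the difference-in-means estimator `τ̂` is conditionally unbiased: `E[τ̂ | φ(W) ≤ a] = τ`.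
Allocations are encoded as `w : Fin n → Bool` with indicator `fun i => if w i then 1 else 0`. -/
theorem pca_rerandomization_unbiased_tauhat
    (n : ℕ) (hn : 0 < n) (hneven : Even n)
    (y0 y1 : Fin n → ℝ)
    (τ : ℝ) (hτ : τ = ((1 : ℝ) / n) * ∑ i, (y1 i - y0 i))
    (φ : (Fin n → Bool) → ℝ)
    (hφ : ∀ w, φ w = φ (fun i => ! w i))
    (a : ℝ) (ha : 0 < a)
    (B : Set (Fin n → Bool))
    (hB : B = {w | ∑ i, (if w i then 1 else 0 : ℕ) = n / 2})
    (μ : Measure (Fin n → Bool)) (hμ : μ = uniformOn B)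
    (A : Set (Fin n → Bool)) (hA : A = {w | φ w ≤ a})
    (hpos : μ A ≠ 0)
    (y : (Fin n → Bool) → Fin n → ℝ)
    (hy : ∀ w i, y w i =
      (if w i then (1 : ℝ) else 0) * y1 i + (1 - if w i then (1 : ℝ) else 0) * y0 i)
    (τhat : (Fin n → Bool) → ℝ)
    (hτhat : ∀ w, τhat w = ((2 : ℝ) / n) *
      ((∑ i, (if w i then (1 : ℝ) else 0) * y w i) -
        ∑ i, (1 - if w i then (1 : ℝ) else 0) * y w i)) :
    ∫ w, τhat w ∂(μ[|A]) = τ := by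
  subst hμ
  have hprob : IsProbabilityMeasure ((uniformOn B)[|A]) := cond_isProbabilityMeasure hpos
  have hinv : Function.Involutive (fun (w : Fin n → Bool) i => !w i) := fun w => by simp
  have hBinv : (fun (w : Fin n → Bool) i => !w i) ⁻¹' B = B := by
    subst hB
    ext w
    refine ⟨fun h => ?_, fun h => sum_ite_not_eq_half hneven h⟩
    have h' := sum_ite_not_eq_half hneven h
    simpa using h'
  have hAinv : (fun (w : Fin n → Bool) i => !w i) ⁻¹' A = A := by
    subst hA
    ext w
    simp only [Set.mem_preimage, Set.mem_ofPred_eq, ← hφ w]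
  have hcond : (uniformOn B)[|A] = Measure.count[|B ∩ A] :=
    cond_cond_eq_cond_inter' B.toFinite.measurableSet A.toFinite.measurableSet
      (Measure.count_apply_lt_top.2 B.toFinite).ne
  have hpres : MeasurePreserving (fun (w : Fin n → Bool) i => !w i)
      ((uniformOn B)[|A]) ((uniformOn B)[|A]) := by
    rw [hcond]
    exact measurePreserving_cond_count_of_involutive hinv (by rw [Set.preimage_inter, hBinv, hAinv])
  refine integral_eq_of_add_comp_eq hpres fun w => ?_
  have hsum : ((∑ i, (if w i then (1 : ℝ) else 0) * y w i) -
        ∑ i, (1 - if w i then (1 : ℝ) else 0) * y w i) +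
      ((∑ i, (if !w i then (1 : ℝ) else 0) * y (fun i => !w i) i) -
        ∑ i, (1 - if !w i then (1 : ℝ) else 0) * y (fun i => !w i) i) = ∑ i, (y1 i - y0 i) := by
    rw [← Finset.sum_sub_distrib, ← Finset.sum_sub_distrib, ← Finset.sum_add_distrib]
    refine Finset.sum_congr rfl fun i _ => ?_
    rw [hy, hy]
    cases w i <;> simp <;> ring
  rw [hτhat, hτhat, ← mul_add, hsum, hτ]
  ring
end

section
/- Let 1 ≤ k ≤ d, let c_1,…,c_d > 0, and let η = (η_1,…,η_d) have independent coordinates with η_j ~ N(0, c_j). Set M_k = Σ_{j=1}^k η_j²/c_j and let a > 0. Then for every j ∈ {1,…,k}, E[ η_j² | M_k ≤ a ] = (c_j/k) · E[ M_k | M_k ≤ a ] = c_j · P(χ²_{k+2} ≤ a)/P(χ²_k ≤ a); in particular the conditional variance of each of the first k coordinates given {M_k ≤ a} equals c_j · P(χ²_{k+2} ≤ a)/P(χ²_k ≤ a). -/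
open MeasureTheory ProbabilityTheory Finset

/-- `P(χ²_m ≤ a)`: the CDF at `a` of the chi-squared distribution with `m` degrees of
freedom, i.e. the Gamma distribution with shape `m/2` and rate `1/2`. -/
noncomputable def chiSqCDF (m : ℕ) (a : ℝ) : ℝ :=
  (gammaMeasure ((m : ℝ) / 2) (1 / 2) (Set.Iic a)).toReal

lemma integral_gammaMeasure {E : Type*} [NormedAddCommGroup E] [NormedSpace ℝ E] {a r : ℝ}
    (ha : 0 < a) (hr : 0 < r) (f : ℝ → E) :
    ∫ x, f x ∂(gammaMeasure a r) =
      ∫ x in Set.Ioi 0, (r ^ a / Real.Gamma a * x ^ (a - 1) * Real.exp (-(r * x))) • f x := by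
  have hm : Measurable (gammaPDF a r) := (measurable_gammaPDFReal a r).ennreal_ofReal
  rw [gammaMeasure, integral_withDensity_eq_integral_toReal_smul hm (by simp [gammaPDF]),
    ← integral_Ici_eq_integral_Ioi, ← integral_indicator measurableSet_Ici]
  refine integral_congr_ae (.of_forall fun x => ?_)
  simp only [gammaPDF, ENNReal.toReal_ofReal (gammaPDFReal_nonneg ha hr x)]
  by_cases hx : 0 ≤ x <;> simp [gammaPDFReal, hx]

lemma mgf_gammaMeasure {a r t : ℝ} (ha : 0 < a) (hr : 0 < r) (ht : t < r) :
    mgf id (gammaMeasure a r) t = r ^ a * (1 / (r - t)) ^ a := by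
  rw [mgf, integral_gammaMeasure ha hr]
  have h := Real.integral_rpow_mul_exp_neg_mul_Ioi ha (sub_pos.2 ht)
  have hΓ := (Real.Gamma_pos_of_pos ha).ne'
  calc _ = ∫ x in Set.Ioi 0, r ^ a / Real.Gamma a * (x ^ (a - 1) * Real.exp (-((r - t) * x))) := by
        refine integral_congr_ae (.of_forall fun x => ?_)
        simp only [id, smul_eq_mul, mul_assoc, ← Real.exp_add]
        ring_nf
    _ = _ := by rw [integral_const_mul, h]; field_simp

lemma Iio_subset_integrableExpSet_gammaMeasure {a r : ℝ} (ha : 0 < a) (hr : 0 < r) :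
    Set.Iio r ⊆ integrableExpSet id (gammaMeasure a r) := fun t ht => by
  have h : 0 < r - t := sub_pos.2 ht
  refine Integrable.of_integral_ne_zero (ne_of_gt ?_)
  change 0 < mgf id (gammaMeasure a r) t
  rw [mgf_gammaMeasure ha hr ht]
  positivity

lemma charFun_gammaMeasure {a r : ℝ} (ha : 0 < a) (hr : 0 < r) (t : ℝ) :
    charFun (gammaMeasure a r) t = (r : ℂ) ^ (a : ℂ) * (1 / (r - t * Complex.I)) ^ (a : ℂ) := by
  let U : Set ℂ := {z | z.re < r}
  have hU : IsOpen U := isOpen_lt Complex.continuous_re continuous_const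
  have hpre : IsPreconnected U := (convex_halfSpace_re_lt r).isPreconnected
  have hsub : U ⊆ {z | z.re ∈ interior (integrableExpSet id (gammaMeasure a r))} := fun z hz =>
    interior_maximal (Iio_subset_integrableExpSet_gammaMeasure ha hr) isOpen_Iio hz
  have hf : AnalyticOnNhd ℂ (complexMGF id (gammaMeasure a r)) U :=
    analyticOnNhd_complexMGF.mono hsub
  have hg : AnalyticOnNhd ℂ (fun z : ℂ => (r : ℂ) ^ (a : ℂ) * (1 / (r - z)) ^ (a : ℂ)) U := by
    refine DifferentiableOn.analyticOnNhd (fun z hz => ?_) hU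
    have hre : 0 < ((r : ℂ) - z).re := by simpa [U] using hz
    have h0 : (r : ℂ) - z ≠ 0 := fun h => by simp [h] at hre
    have hs : 1 / ((r : ℂ) - z) ∈ Complex.slitPlane := by
      left
      rw [one_div, Complex.inv_re]
      exact div_pos hre (Complex.normSq_pos.2 h0)
    exact (((differentiableAt_const _).div (by fun_prop) h0).cpow_const hs |>.const_mul
      _).differentiableWithinAt
  have hreal (x : ℝ) (hx : x < r) : complexMGF id (gammaMeasure a r) x =
      (r : ℂ) ^ (a : ℂ) * (1 / (r - x)) ^ (a : ℂ) := by
    rw [complexMGF_ofReal, mgf_gammaMeasure ha hr hx, Complex.ofReal_mul,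
      Complex.ofReal_cpow hr.le, Complex.ofReal_cpow (one_div_pos.2 (sub_pos.2 hx)).le]
    push_cast
    rfl
  have hfreq : ∃ᶠ z in nhdsWithin (0 : ℂ) {0}ᶜ, complexMGF id (gammaMeasure a r) z =
      (r : ℂ) ^ (a : ℂ) * (1 / (r - z)) ^ (a : ℂ) := by
    have htend : Filter.Tendsto (fun x : ℝ => (x : ℂ)) (nhdsWithin 0 {0}ᶜ)
        (nhdsWithin (0 : ℂ) {0}ᶜ) := by
      refine tendsto_nhdsWithin_iff.2 ⟨?_, ?_⟩
      · exact (Complex.continuous_ofReal.tendsto' 0 0 (by simp)).mono_left nhdsWithin_le_nhds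
      · filter_upwards [self_mem_nhdsWithin] with x hx
        simpa using hx
    refine htend.frequently (Filter.Eventually.frequently ?_)
    filter_upwards [nhdsWithin_le_nhds (Iio_mem_nhds hr)] with x hx using hreal x hx
  have h := hf.eqOn_of_preconnected_of_frequently_eq hg hpre (z₀ := 0) (by simpa [U] using hr) hfreq
  rw [← complexMGF_id_mul_I]
  exact h (by simpa [U] using hr)

lemma charFun_map_sq_div_gaussianReal {c : ℝ} (hc : 0 < c) (t : ℝ) :
    charFun ((gaussianReal 0 c.toNNReal).map (fun x => x ^ 2 / c)) t =
      ((1 / 2 : ℝ) : ℂ) ^ ((1 / 2 : ℝ) : ℂ) *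
        (1 / (((1 / 2 : ℝ) : ℂ) - t * Complex.I)) ^ ((1 / 2 : ℝ) : ℂ) := by
  have hv : c.toNNReal ≠ 0 := by simpa using hc
  have hcC : (c : ℂ) ≠ 0 := by exact_mod_cast hc.ne'
  set w : ℂ := ((1 / 2 : ℝ) : ℂ) - t * Complex.I with hw
  have hwre : w.re = 1 / 2 := by simp [hw]
  have hw0 : w ≠ 0 := fun h => by simp [h] at hwre
  have hb : 0 < (w / c).re := by rw [Complex.div_ofReal_re, hwre]; positivity
  rw [charFun_apply_real, integral_map (by fun_prop) (by fun_prop),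
    integral_gaussianReal_eq_integral_smul hv]
  calc _ = ∫ x : ℝ, (((√(2 * Real.pi * c))⁻¹ : ℝ) : ℂ) * Complex.exp (-(w / c) * x ^ 2) := by
        refine integral_congr_ae (.of_forall fun x => ?_)
        simp only [gaussianPDFReal, Real.coe_toNNReal _ hc.le, Complex.real_smul,
          Complex.ofReal_mul, Complex.ofReal_exp, mul_assoc, ← Complex.exp_add, hw]
        congr 2
        push_cast
        field_simp
        ring
    _ = _ := by
        rw [integral_const_mul, integral_gaussian_complex hb]
        have hsplit : (Real.pi : ℂ) / (w / c) =
            ((2 * Real.pi * c : ℝ) : ℂ) * (((1 / 2 : ℝ) : ℂ) * (1 / w)) := by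
          push_cast
          field_simp
        have hmul {p : ℝ} (hp : 0 < p) {z : ℂ} (hz : z ≠ 0) (s : ℂ) :
            ((p : ℂ) * z) ^ s = (p : ℂ) ^ s * z ^ s := by
          have hp0 : (p : ℂ) ≠ 0 := by exact_mod_cast hp.ne'
          rw [Complex.cpow_def_of_ne_zero (mul_ne_zero hp0 hz), Complex.cpow_def_of_ne_zero hp0,
            Complex.cpow_def_of_ne_zero hz, Complex.log_ofReal_mul hp hz, Complex.ofReal_log hp.le,
            add_mul, Complex.exp_add]
        have hpos : 0 < 2 * Real.pi * c := by positivity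
        have hw1 : 1 / w ≠ 0 := one_div_ne_zero hw0
        have hsq : (√(2 * Real.pi * c) : ℂ) ≠ 0 := by
          exact_mod_cast (Real.sqrt_pos.2 hpos).ne'
        have hexp : (1 / 2 : ℂ) = ((1 / 2 : ℝ) : ℂ) := by simp
        rw [hsplit, hexp, hmul hpos (mul_ne_zero (by simp) hw1),
          hmul one_half_pos hw1, ← Complex.ofReal_cpow hpos.le, ← Real.sqrt_eq_rpow,
          Complex.ofReal_inv, inv_mul_cancel_left₀ hsq]

lemma map_sq_div_gaussianReal {c : ℝ} (hc : 0 < c) :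
    (gaussianReal 0 c.toNNReal).map (fun x => x ^ 2 / c) = gammaMeasure (1 / 2) (1 / 2) := by
  have := isProbabilityMeasure_gammaMeasure (a := 1 / 2) (r := 1 / 2) one_half_pos one_half_pos
  refine Measure.ext_of_charFun (funext fun t => ?_)
  rw [charFun_map_sq_div_gaussianReal hc, charFun_gammaMeasure one_half_pos one_half_pos]

lemma map_sum_pi_gammaMeasure {ι : Type*} [Fintype ι] {a r : ℝ} (ha : 0 < a) (hr : 0 < r)
    {s : Finset ι} (hs : s.Nonempty) :
    (Measure.pi fun _ : ι => gammaMeasure a r).map (fun y => ∑ i ∈ s, y i) =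
      gammaMeasure (#s * a) r := by
  have := isProbabilityMeasure_gammaMeasure ha hr
  have ha' : 0 < #s * a := mul_pos (by exact_mod_cast hs.card_pos) ha
  have := isProbabilityMeasure_gammaMeasure ha' hr
  have hind := (iIndepFun_pi (μ := fun _ : ι => gammaMeasure a r) (X := fun _ => id)
    fun _ => aemeasurable_id).restrict s
  refine Measure.ext_of_charFun (funext fun t => ?_)
  have h := hind.charFun_map_fun_finsetSum_eq_prod (fun i _ => (measurable_pi_apply i).aemeasurable)
  change charFun (Measure.map (fun y : ι → ℝ => ∑ i ∈ s, y i) _) = _ at h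
  rw [h, Finset.prod_apply, Finset.prod_congr rfl (g := fun _ => charFun (gammaMeasure a r) t)
    fun i _ => by rw [(measurePreserving_eval (fun _ : ι => gammaMeasure a r) i).map_eq],
    prod_const, charFun_gammaMeasure ha hr, charFun_gammaMeasure ha' hr, mul_pow]
  push_cast
  rw [Complex.cpow_nat_mul, Complex.cpow_nat_mul]

lemma setIntegral_id_gammaMeasure {a r : ℝ} (ha : 0 < a) (hr : 0 < r) {s : Set ℝ}
    (hs : MeasurableSet s) :
    ∫ x in s, x ∂(gammaMeasure a r) = a / r * (gammaMeasure (a + 1) r).real s := by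
  rw [← integral_indicator hs, ← integral_indicator_one hs, integral_gammaMeasure ha hr,
    integral_gammaMeasure (by positivity) hr, ← integral_const_mul]
  refine setIntegral_congr_fun measurableSet_Ioi fun x (hx : 0 < x) => ?_
  have hΓ := (Real.Gamma_pos_of_pos ha).ne'
  by_cases h : x ∈ s
  · simp only [h, Set.indicator_of_mem, smul_eq_mul, Pi.one_apply, Real.Gamma_add_one ha.ne',
      Real.rpow_add_one hr.ne', add_sub_cancel_right, Real.rpow_sub_one hx.ne']
    field_simp
  · simp [h]

lemma integrable_id_gammaMeasure {a r : ℝ} (ha : 0 < a) (hr : 0 < r) :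
    Integrable (fun x => x) (gammaMeasure a r) := by
  have := isProbabilityMeasure_gammaMeasure (a := a + 1) (by positivity) hr
  refine Integrable.of_integral_ne_zero ?_
  rw [← setIntegral_univ, setIntegral_id_gammaMeasure ha hr .univ, probReal_univ]
  positivity

lemma setIntegral_eval_pi_const_swap {ι : Type*} [Fintype ι] [DecidableEq ι] (ν : Measure ℝ)
    [SigmaFinite ν] {s : Finset ι} {i j : ι} (hi : i ∈ s) (hj : j ∈ s) (B : Set ℝ) :
    ∫ y in {y : ι → ℝ | ∑ l ∈ s, y l ∈ B}, y i ∂(Measure.pi fun _ => ν) =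
      ∫ y in {y : ι → ℝ | ∑ l ∈ s, y l ∈ B}, y j ∂(Measure.pi fun _ => ν) := by
  have hmp := measurePreserving_piCongrLeft (α := fun _ : ι => ℝ) (fun _ => ν) (Equiv.swap i j)
  have happ (y : ι → ℝ) (l : ι) :
      MeasurableEquiv.piCongrLeft (fun _ : ι => ℝ) (Equiv.swap i j) y l =
        y (Equiv.swap i j l) := by
    simpa using MeasurableEquiv.piCongrLeft_apply_apply (β := fun _ : ι => ℝ) (Equiv.swap i j) y
      (Equiv.swap i j l)
  have hmem : {l | Equiv.swap i j l ≠ l} ⊆ s := fun l hl => by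
    by_contra hls
    exact hl (Equiv.swap_apply_of_ne_of_ne (fun h => hls (by simpa [h] using hi))
      fun h => hls (by simpa [h] using hj))
  rw [← hmp.setIntegral_preimage_emb (MeasurableEquiv.measurableEmbedding _)]
  simp only [Set.preimage_ofPred_eq, happ, Equiv.swap_apply_left]
  simp_rw [fun y : ι → ℝ => Equiv.Perm.sum_comp (Equiv.swap i j) s y hmem]

lemma setIntegral_eval_pi_gammaMeasure {ι : Type*} [Fintype ι] {a r : ℝ} (ha : 0 < a)
    (hr : 0 < r) {s : Finset ι} {i : ι} (hi : i ∈ s) {B : Set ℝ} (hB : MeasurableSet B) :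
    ∫ y in {y : ι → ℝ | ∑ l ∈ s, y l ∈ B}, y i ∂(Measure.pi fun _ => gammaMeasure a r) =
      a / r * (gammaMeasure (#s * a + 1) r).real B := by
  classical
  have := isProbabilityMeasure_gammaMeasure ha hr
  have hs : s.Nonempty := ⟨i, hi⟩
  have hcard : (0 : ℝ) < #s := by exact_mod_cast hs.card_pos
  have hsum : ∫ y in {y : ι → ℝ | ∑ l ∈ s, y l ∈ B}, ∑ l ∈ s, y l
      ∂(Measure.pi fun _ => gammaMeasure a r) =
      #s * a / r * (gammaMeasure (#s * a + 1) r).real B := by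
    rw [← setIntegral_id_gammaMeasure (by positivity) hr hB, ← map_sum_pi_gammaMeasure ha hr hs,
      setIntegral_map hB (by fun_prop) (by fun_prop)]
    rfl
  have hint (l : ι) : Integrable (fun y : ι → ℝ => y l)
      (Measure.pi fun _ => gammaMeasure a r) :=
    integrable_comp_eval (i := l) (f := fun x => x) (integrable_id_gammaMeasure ha hr)
  rw [integral_finsetSum s fun l _ => (hint l).integrableOn,
    sum_congr rfl fun l hl => setIntegral_eval_pi_const_swap _ hl hi B, sum_const,
    nsmul_eq_mul, mul_div_assoc, mul_assoc] at hsum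
  exact mul_left_cancel₀ hcard.ne' hsum

lemma integral_cond_eq {Ω : Type*} {mΩ : MeasurableSpace Ω} (μ : Measure Ω) (A : Set Ω)
    (f : Ω → ℝ) : ∫ x, f x ∂(μ[|A]) = (μ.real A)⁻¹ * ∫ x in A, f x ∂μ := by
  rw [ProbabilityTheory.cond, integral_smul_measure, ENNReal.toReal_inv, smul_eq_mul,
    measureReal_def]

lemma setIntegral_eval_pi_eq_zero {ι : Type*} [Fintype ι] {ν : ι → Measure ℝ}
    [∀ i, SigmaFinite (ν i)] (hν : ∀ i, MeasurePreserving (fun x => -x) (ν i) (ν i))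
    {A : Set (ι → ℝ)} (hA : (fun x => -x) ⁻¹' A = A) (i : ι) :
    ∫ x in A, x i ∂(Measure.pi ν) = 0 := by
  have hmp : MeasurePreserving (fun x : ι → ℝ => -x) (Measure.pi ν) (Measure.pi ν) :=
    measurePreserving_pi ν ν hν
  have h := hmp.setIntegral_preimage_emb (MeasurableEquiv.neg _).measurableEmbedding
    (fun x => x i) A
  simp only [hA, Pi.neg_apply, integral_neg] at h
  linarith

/-- Let `η = (η₁,…,η_d)` have independent coordinates with
`η_j ~ N(0, c_j)`, `c_j > 0` (formalized as the product Gaussian measure `μ` on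
`Fin d → ℝ`), let `M_k x = ∑_{j<k} x_j²/c_j` for `1 ≤ k ≤ d` and `a > 0`. Then for
every `j < k`: `E[η_j² | M_k ≤ a] = (c_j/k)·E[M_k | M_k ≤ a]
= c_j · P(χ²_{k+2} ≤ a)/P(χ²_k ≤ a)`; in particular the conditional variance of `η_j`
given `{M_k ≤ a}` equals `c_j · P(χ²_{k+2} ≤ a)/P(χ²_k ≤ a)`. -/
theorem pca_cond_variance_top_components
    (d k : ℕ) (hk1 : 1 ≤ k) (hkd : k ≤ d)
    (c : Fin d → ℝ) (hc : ∀ j, 0 < c j)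
    (μ : Measure (Fin d → ℝ))
    (hμ : μ = Measure.pi fun j => gaussianReal 0 (c j).toNNReal)
    (Mk : (Fin d → ℝ) → ℝ)
    (hMk : ∀ x, Mk x = ∑ j ∈ Finset.univ.filter (fun j : Fin d => (j : ℕ) < k),
      (x j) ^ 2 / c j)
    (a : ℝ) (ha : 0 < a) :
    ∀ j : Fin d, (j : ℕ) < k →
      (∫ x, (x j) ^ 2 ∂(μ[|{x | Mk x ≤ a}]) =
        (c j / k) * ∫ x, Mk x ∂(μ[|{x | Mk x ≤ a}])) ∧
      (∫ x, (x j) ^ 2 ∂(μ[|{x | Mk x ≤ a}]) =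
        c j * (chiSqCDF (k + 2) a / chiSqCDF k a)) ∧
      variance (fun x => x j) (μ[|{x | Mk x ≤ a}]) =
        c j * (chiSqCDF (k + 2) a / chiSqCDF k a) := by
  subst hμ
  set μ : Measure (Fin d → ℝ) := Measure.pi fun j => gaussianReal 0 (c j).toNNReal with hμ
  set s : Finset (Fin d) := univ.filter fun j : Fin d => (j : ℕ) < k with hs
  obtain rfl : Mk = fun x => ∑ j ∈ s, (x j) ^ 2 / c j := funext hMk
  intro j hj
  have hjs : j ∈ s := by simpa [hs] using hj
  have hcard : #s = k := by
    simp [hs, Fin.card_filter_val_lt, hkd]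
  have hk : (0 : ℝ) < k := by exact_mod_cast hk1
  have hcj : c j ≠ 0 := (hc j).ne'
  have hprob := isProbabilityMeasure_gammaMeasure (a := 1 / 2) (r := 1 / 2) one_half_pos
    one_half_pos
  set ν : Measure (Fin d → ℝ) := Measure.pi fun _ => gammaMeasure (1 / 2) (1 / 2) with hν
  have hT : MeasurePreserving (fun (x : Fin d → ℝ) i => (x i) ^ 2 / c i) μ ν :=
    measurePreserving_pi _ _ fun i => ⟨by fun_prop, map_sq_div_gaussianReal (hc i)⟩
  set B : Set (Fin d → ℝ) := {y | ∑ i ∈ s, y i ∈ Set.Iic a} with hB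
  have hBm : MeasurableSet B := measurableSet_Iic.preimage (by fun_prop)
  set A : Set (Fin d → ℝ) := {x | ∑ i ∈ s, (x i) ^ 2 / c i ≤ a} with hA
  have hAB : A = (fun (x : Fin d → ℝ) i => (x i) ^ 2 / c i) ⁻¹' B := rfl
  have hAμ : μ.real A = chiSqCDF k a := by
    rw [hAB, hT.measureReal_preimage hBm.nullMeasurableSet, chiSqCDF, measureReal_def,
      div_eq_mul_one_div, ← hcard,
      ← map_sum_pi_gammaMeasure one_half_pos one_half_pos ⟨j, hjs⟩,
      Measure.map_apply (by fun_prop) measurableSet_Iic]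
    rfl
  have hterm (i : Fin d) (hi : i ∈ s) :
      ∫ x in A, (x i) ^ 2 / c i ∂μ = chiSqCDF (k + 2) a := by
    have h := setIntegral_eval_pi_gammaMeasure (a := 1 / 2) (r := 1 / 2) one_half_pos
      one_half_pos hi (measurableSet_Iic (a := a))
    have hmap := setIntegral_map (μ := μ) (g := fun (x : Fin d → ℝ) l => (x l) ^ 2 / c l)
      (f := fun y => y i) hBm (measurable_pi_apply i).aestronglyMeasurable
      hT.measurable.aemeasurable
    rw [hT.map_eq, h] at hmap
    rw [hAB, ← hmap, hcard, chiSqCDF, measureReal_def]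
    push_cast
    ring_nf
  have hsq : ∫ x, (x j) ^ 2 ∂(μ[|A]) = c j * (chiSqCDF (k + 2) a / chiSqCDF k a) := by
    rw [← hterm j hjs, integral_cond_eq, hAμ, integral_div]
    field_simp
  have hint (i : Fin d) : Integrable (fun x : Fin d → ℝ => (x i) ^ 2 / c i) μ := by
    have h : Integrable (fun y : Fin d → ℝ => y i) ν :=
      integrable_comp_eval (i := i) (f := fun x => x)
        (integrable_id_gammaMeasure one_half_pos one_half_pos)
    exact hT.integrable_comp_of_integrable h
  have hM : ∫ x, ∑ i ∈ s, (x i) ^ 2 / c i ∂(μ[|A]) =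
      k * (chiSqCDF (k + 2) a / chiSqCDF k a) := by
    rw [integral_cond_eq, hAμ, integral_finsetSum s fun i _ => (hint i).integrableOn,
      sum_congr rfl hterm, sum_const, hcard, nsmul_eq_mul]
    ring
  refine ⟨?_, hsq, ?_⟩
  · rw [hM, hsq]
    field_simp
  · have hmean : ∫ x, x j ∂(μ[|A]) = 0 := by
      have hneg (i : Fin d) : MeasurePreserving (fun x => -x) (gaussianReal 0 (c i).toNNReal)
          (gaussianReal 0 (c i).toNNReal) :=
        ⟨measurable_neg, by simpa using gaussianReal_map_neg (μ := 0) (v := (c i).toNNReal)⟩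
      have hAneg : (fun x => -x) ⁻¹' A = A := by ext; simp [hA]
      rw [integral_cond_eq, hμ, setIntegral_eval_pi_eq_zero hneg hAneg j, mul_zero]
    rw [variance_of_integral_eq_zero (measurable_pi_apply j).aemeasurable hmean, hsq]
end
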